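/- Let n = 2p with p ≥ 2, let C be a circle of the plane, and let A be a similarity-equivariant deterministic oblivious algorithm that solves UTP on C in finite time. Then for every strict biangular configuration P of n points on C and every point x in the support of P, A x P ≠ x; i.e., every robot activated in a strict biangular circle moves to a position different from its current one. -/

import Mathlib

open Real

/-- The consecutive central gaps of angles `θ 0 < θ 1 < ⋯ < θ (n-1) < θ 0 + 2π`. -/
noncomputable def gap (n : ℕ) (θ : Fin n → ℝ) (i : Fin n) : ℝ :=
  if h : (i : ℕ) + 1 < n then θ ⟨(i : ℕ) + 1, h⟩ - θ i
  else θ ⟨0, i.pos⟩ + 2 * π - θ i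

/-- A similarity of the plane (identified with `ℂ`): `f x = s • L x + v` with `s > 0`
and `L` a linear isometry. -/
def IsSimilarity (f : ℂ → ℂ) : Prop :=
  ∃ (s : ℝ) (L : ℂ ≃ₗᵢ[ℝ] ℂ) (v : ℂ), 0 < s ∧ ∀ x, f x = s • L x + v

/-- A deterministic oblivious algorithm is similarity-equivariant if it commutes with
every similarity of the plane. -/
def Equivariant (A : ℂ → Multiset ℂ → ℂ) : Prop :=
  ∀ f : ℂ → ℂ, IsSimilarity f → ∀ (x : ℂ) (m : Multiset ℂ),
    A (f x) (Multiset.map f m) = f (A x m)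

open scoped Classical

/-- The execution of algorithm `A` from initial configuration `x₀` under schedule `S`:
at each step, exactly the robots in `S t` apply `A` to their own position and the
multiset of all current positions; the others stay put. -/
noncomputable def exec (n : ℕ) (A : ℂ → Multiset ℂ → ℂ) (x₀ : Fin n → ℂ)
    (S : ℕ → Set (Fin n)) : ℕ → Fin n → ℂ
  | 0 => x₀
  | t + 1 => fun i =>
      if i ∈ S t then
        A (exec n A x₀ S t i) (Multiset.map (exec n A x₀ S t) Finset.univ.val)
      else exec n A x₀ S t i

/-- A fair schedule: every step activates a nonempty set of robots, and every robot is
activated infinitely often. -/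
def FairSchedule (n : ℕ) (S : ℕ → Set (Fin n)) : Prop :=
  (∀ t, (S t).Nonempty) ∧ ∀ (i : Fin n) (T : ℕ), ∃ t, T ≤ t ∧ i ∈ S t

/-- The positions form a regular `n`-gon on the circle of center `c` and radius `ρ`:
up to a permutation, they are the points of angles `φ + 2πk/n`, `k ∈ Fin n`. -/
def FormsRegularNgon (n : ℕ) (c : ℂ) (ρ : ℝ) (pos : Fin n → ℂ) : Prop :=
  ∃ (φ : ℝ) (σ : Equiv.Perm (Fin n)), ∀ i : Fin n,
    pos (σ i) = c + (ρ : ℂ) * Complex.exp (((φ + 2 * π * ((i : ℕ) : ℝ) / n : ℝ) : ℂ) * Complex.I)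

/-- `A` solves the Uniform Transformation Problem on the circle of center `c` and
radius `ρ` in finite time: from every configuration of `n` distinct points of the
circle and under every fair schedule, all robots stay on the circle forever and at
some time the positions form a regular `n`-gon. -/
def SolvesUTP (n : ℕ) (c : ℂ) (ρ : ℝ) (A : ℂ → Multiset ℂ → ℂ) : Prop :=
  ∀ x₀ : Fin n → ℂ, Function.Injective x₀ → (∀ i, x₀ i ∈ Metric.sphere c ρ) →
    ∀ S : ℕ → Set (Fin n), FairSchedule n S →
      (∀ t i, exec n A x₀ S t i ∈ Metric.sphere c ρ) ∧
      ∃ t, FormsRegularNgon n c ρ (exec n A x₀ S t)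

/-- A strict biangular configuration on the circle of center `c` and radius `ρ`:
`n` points of the circle whose consecutive central gaps, in cyclic angular order,
alternate between two positive values `α ≠ β`. -/
def IsStrictBiangularOn (n : ℕ) (c : ℂ) (ρ : ℝ) (P : Multiset ℂ) : Prop :=
  ∃ (θ : Fin n → ℝ) (α β : ℝ), α ≠ β ∧ 0 < α ∧ 0 < β ∧ StrictMono θ ∧
    (∀ i : Fin n, gap n θ i = if (i : ℕ) % 2 = 0 then α else β) ∧
    P = Multiset.map (fun i => c + (ρ : ℂ) * Complex.exp (((θ i : ℝ) : ℂ) * Complex.I))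
          Finset.univ.val

/-- The point of angle `t` on the circle of center `c` and radius `ρ`. -/
noncomputable def circlePoint (c : ℂ) (ρ t : ℝ) : ℂ :=
  c + (ρ : ℂ) * Complex.exp ((t : ℂ) * Complex.I)

theorem circlePoint_mem_sphere (c : ℂ) {ρ : ℝ} (hρ : 0 < ρ) (t : ℝ) :
    circlePoint c ρ t ∈ Metric.sphere c ρ := by
  simp [circlePoint, Complex.norm_exp_ofReal_mul_I, abs_of_pos hρ]

theorem circlePoint_eq_iff (c : ℂ) {ρ : ℝ} (hρ : 0 < ρ) {s t : ℝ} :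
    circlePoint c ρ s = circlePoint c ρ t ↔ ∃ k : ℤ, s = t + k * (2 * π) := by
  have hρ' : (ρ : ℂ) ≠ 0 := by exact_mod_cast hρ.ne'
  rw [circlePoint, circlePoint, add_right_inj, mul_right_inj' hρ',
    Complex.exp_eq_exp_iff_exists_int]
  refine exists_congr fun k => ?_
  rw [show (t : ℂ) * Complex.I + k * (2 * π * Complex.I) =
    ((t + k * (2 * π) : ℝ) : ℂ) * Complex.I by push_cast; ring,
    mul_left_inj' Complex.I_ne_zero, Complex.ofReal_inj]

theorem IsSimilarity.injective {f : ℂ → ℂ} (hf : IsSimilarity f) : Function.Injective f := by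
  obtain ⟨s, L, v, hs, hf⟩ := hf
  intro x y hxy
  rw [hf, hf, add_left_inj] at hxy
  exact L.injective (smul_right_injective ℂ hs.ne' hxy)

theorem exists_similarity_add_angle (c : ℂ) (ρ φ : ℝ) :
    ∃ f, IsSimilarity f ∧ ∀ t, f (circlePoint c ρ t) = circlePoint c ρ (φ + t) := by
  refine ⟨fun z => (1 : ℝ) • rotation (Circle.exp φ) z + (c - rotation (Circle.exp φ) c),
    ⟨1, _, _, one_pos, fun _ => rfl⟩, fun t => ?_⟩
  simp only [circlePoint, rotation_apply, Circle.coe_exp, one_smul]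
  push_cast
  rw [add_mul, Complex.exp_add]
  ring

theorem exists_similarity_sub_angle (c : ℂ) (ρ φ : ℝ) :
    ∃ f, IsSimilarity f ∧ ∀ t, f (circlePoint c ρ t) = circlePoint c ρ (φ - t) := by
  refine ⟨fun z => (1 : ℝ) • (Complex.conjLIE.trans (rotation (Circle.exp φ))) z +
      (c - (Complex.conjLIE.trans (rotation (Circle.exp φ))) c),
    ⟨1, _, _, one_pos, fun _ => rfl⟩, fun t => ?_⟩
  simp only [circlePoint, LinearIsometryEquiv.trans_apply, Complex.conjLIE_apply, rotation_apply,
    Circle.coe_exp, one_smul, map_add, map_mul, Complex.conj_ofReal, ← Complex.exp_conj,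
    Complex.conj_I]
  push_cast
  rw [sub_mul, Complex.exp_sub, mul_neg, Complex.exp_neg]
  ring

/-- The `i`-th angle of a biangular sequence starting at `a`, with gaps `α` and `β`. -/
noncomputable def biangle (a α β : ℝ) (i : ℕ) : ℝ :=
  a + (i / 2 : ℕ) * (α + β) + if i % 2 = 0 then 0 else α

theorem biangle_succ (a α β : ℝ) (i : ℕ) :
    biangle a α β (i + 1) = biangle a α β i + if i % 2 = 0 then α else β := by
  rcases Nat.even_or_odd' i with ⟨k, rfl | rfl⟩
  · have h1 : (2 * k + 1) / 2 = k := by omega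
    have h2 : (2 * k + 1) % 2 = 1 := by omega
    simp [biangle, h1, h2]
  · have h1 : (2 * k + 1 + 1) / 2 = k + 1 := by omega
    have h2 : (2 * k + 1 + 1) % 2 = 0 := by omega
    have h3 : (2 * k + 1) / 2 = k := by omega
    have h4 : (2 * k + 1) % 2 = 1 := by omega
    simp only [biangle, h1, h2, h3, h4]
    push_cast
    norm_num
    ring

theorem eq_biangle_of_gap {n : ℕ} {θ : Fin n → ℝ} {α β : ℝ} (hn : 0 < n)
    (hgap : ∀ i : Fin n, gap n θ i = if (i : ℕ) % 2 = 0 then α else β) (i : ℕ) (hi : i < n) :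
    θ ⟨i, hi⟩ = biangle (θ ⟨0, hn⟩) α β i := by
  induction i with
  | zero => simp [biangle]
  | succ i ih =>
    have h := hgap ⟨i, by omega⟩
    rw [gap, dif_pos (show i + 1 < n from hi)] at h
    rw [biangle_succ, ← ih (by omega), ← h]
    ring

theorem mul_add_eq_two_pi_of_gap {p n : ℕ} {θ : Fin n → ℝ} {α β : ℝ} (hn : 0 < n)
    (hnp : n = 2 * p)
    (hgap : ∀ i : Fin n, gap n θ i = if (i : ℕ) % 2 = 0 then α else β) :
    p * (α + β) = 2 * π := by
  have hl : n - 1 < n := by omega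
  have h := hgap ⟨n - 1, hl⟩
  rw [gap, dif_neg (show ¬ (n - 1 + 1 < n) by omega), eq_biangle_of_gap hn hgap (n - 1) hl] at h
  have h' := biangle_succ (θ ⟨0, hn⟩) α β (n - 1)
  rw [← h, show n - 1 + 1 = 2 * p by omega] at h'
  simp only [biangle, Nat.mul_div_cancel_left p two_pos, Nat.mul_mod_right, if_true] at h'
  linarith

/-- The biangular angles indexed by `ℤ`, in either class of the alternation, all give points of
the configuration. -/
theorem exists_biangle_circlePoint (c : ℂ) {ρ : ℝ} (hρ : 0 < ρ) {p : ℕ} (hp : 0 < p)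
    (a α β : ℝ) (hsum : p * (α + β) = 2 * π) (k : ℤ) (b : Bool) :
    ∃ i < 2 * p, circlePoint c ρ (biangle a α β i) =
      circlePoint c ρ (a + k * (α + β) + if b then α else 0) := by
  have hp' : (0 : ℤ) < p := by exact_mod_cast hp
  have h0 := Int.emod_nonneg k hp'.ne'
  have h1 := Int.emod_lt_of_pos k hp'
  obtain ⟨m, hm⟩ := Int.eq_ofNat_of_zero_le h0
  have hk : (k : ℝ) = p * (k / (p : ℤ) : ℤ) + m := by
    have := Int.mul_ediv_add_emod k p
    rw [hm] at this
    exact_mod_cast this.symm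
  refine ⟨2 * m + if b then 1 else 0, ?_, ?_⟩
  · split_ifs <;> omega
  · rw [circlePoint_eq_iff c hρ]
    refine ⟨-(k / (p : ℤ)), ?_⟩
    cases b
    · simp only [biangle, Bool.false_eq_true, if_false, add_zero,
        Nat.mul_div_cancel_left m two_pos, Nat.mul_mod_right, if_true]
      rw [hk, ← hsum]
      push_cast
      ring
    · have h3 : (2 * m + 1) / 2 = m := by omega
      have h4 : (2 * m + 1) % 2 = 1 := by omega
      simp only [biangle, if_true, h3, h4, one_ne_zero, if_false]
      rw [hk, ← hsum]
      push_cast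
      ring

theorem map_eq_self_of_nodup {f : ℂ → ℂ} (hf : Function.Injective f) {P : Multiset ℂ}
    (hP : P.Nodup) (hmem : ∀ x ∈ P, f x ∈ P) : P.map f = P := by
  refine Multiset.eq_of_le_of_card_le ?_ (by simp)
  rw [Multiset.le_iff_subset (hP.map hf)]
  intro y hy
  obtain ⟨x, hx, rfl⟩ := Multiset.mem_map.1 hy
  exact hmem x hx

theorem Equivariant.fixed_of_fixed {A : ℂ → Multiset ℂ → ℂ} (hA : Equivariant A) {f : ℂ → ℂ}
    (hf : IsSimilarity f) {P : Multiset ℂ} (hP : P.Nodup) (hmem : ∀ x ∈ P, f x ∈ P) {x : ℂ}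
    (hx : A x P = x) : A (f x) P = f x := by
  have h := hA f hf x P
  rwa [map_eq_self_of_nodup hf.injective hP hmem, hx] at h

/-- The symmetry group of a biangular configuration acts transitively on its points. -/
theorem exists_similarity_biangle (c : ℂ) {ρ : ℝ} (hρ : 0 < ρ) {p : ℕ} (hp : 0 < p)
    (a α β : ℝ) (hsum : p * (α + β) = 2 * π) (i j : ℕ) :
    ∃ f, IsSimilarity f ∧
      f (circlePoint c ρ (biangle a α β i)) = circlePoint c ρ (biangle a α β j) ∧
      ∀ k, ∃ l < 2 * p, circlePoint c ρ (biangle a α β l) =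
        f (circlePoint c ρ (biangle a α β k)) := by
  by_cases hij : i % 2 = j % 2
  · obtain ⟨f, hf, hft⟩ := exists_similarity_add_angle c ρ (biangle a α β j - biangle a α β i)
    refine ⟨f, hf, by rw [hft, sub_add_cancel], fun k => ?_⟩
    obtain ⟨l, hl, h⟩ := exists_biangle_circlePoint c hρ hp a α β hsum
      ((j / 2 : ℕ) - (i / 2 : ℕ) + (k / 2 : ℕ)) (decide (k % 2 ≠ 0))
    refine ⟨l, hl, ?_⟩
    rw [h, hft]
    congr 1
    simp only [biangle, hij, Int.cast_add, Int.cast_sub, Int.cast_natCast]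
    by_cases hk : k % 2 = 0 <;> simp [hk] <;> ring
  · obtain ⟨f, hf, hft⟩ := exists_similarity_sub_angle c ρ (biangle a α β j + biangle a α β i)
    refine ⟨f, hf, by rw [hft, add_sub_cancel_right], fun k => ?_⟩
    obtain ⟨l, hl, h⟩ := exists_biangle_circlePoint c hρ hp a α β hsum
      ((j / 2 : ℕ) + (i / 2 : ℕ) - (k / 2 : ℕ)) (decide (k % 2 = 0))
    refine ⟨l, hl, ?_⟩
    rw [h, hft]
    congr 1
    simp only [biangle, Int.cast_add, Int.cast_sub, Int.cast_natCast]
    rcases Nat.mod_two_eq_zero_or_one i with hi | hi <;>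
      rcases Nat.mod_two_eq_zero_or_one j with hj | hj <;>
      rcases Nat.mod_two_eq_zero_or_one k with hk | hk <;>
      first
      | exact absurd (hi.trans hj.symm) hij
      | (simp [hi, hj, hk]; ring)

theorem exec_eq_of_fixed {n : ℕ} {A : ℂ → Multiset ℂ → ℂ} {x₀ : Fin n → ℂ}
    (h : ∀ i, A (x₀ i) (Multiset.map x₀ Finset.univ.val) = x₀ i) (S : ℕ → Set (Fin n)) (t : ℕ) :
    exec n A x₀ S t = x₀ := by
  induction t with
  | zero => rfl
  | succ t ih =>
    funext i
    simp only [exec, ih, h, ite_self]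

/-- In a regular `n`-gon, angles of vertices differ by multiples of `2π/n`. -/
theorem FormsRegularNgon.exists_int {n : ℕ} {c : ℂ} {ρ : ℝ} (hρ : 0 < ρ) {θ : Fin n → ℝ}
    (h : FormsRegularNgon n c ρ fun i => circlePoint c ρ (θ i)) (i j : Fin n) :
    ∃ m : ℤ, n * (θ i - θ j) = m * (2 * π) := by
  obtain ⟨φ, σ, h⟩ := h
  have hn : (n : ℝ) ≠ 0 := by exact_mod_cast i.pos.ne'
  have key (i : Fin n) : ∃ m : ℤ, n * (θ i - φ) = m * (2 * π) := by
    obtain ⟨i, rfl⟩ := σ.surjective i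
    obtain ⟨k, hk⟩ := (circlePoint_eq_iff c hρ).1 (h i)
    refine ⟨i + n * k, ?_⟩
    rw [hk]
    push_cast
    field_simp
    ring
  obtain ⟨m, hm⟩ := key i
  obtain ⟨l, hl⟩ := key j
  exact ⟨m - l, by push_cast; linarith⟩

theorem circlePoint_injective_of_gap (c : ℂ) {ρ : ℝ} (hρ : 0 < ρ) {n : ℕ} {θ : Fin n → ℝ}
    (hθ : StrictMono θ) (hgap : ∀ i, 0 < gap n θ i) :
    Function.Injective fun i => circlePoint c ρ (θ i) := by
  intro i j hij
  obtain ⟨k, hk⟩ := (circlePoint_eq_iff c hρ).1 hij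
  have hpos : 0 < n := i.pos
  have hl : n - 1 < n := by omega
  have hlast := hgap ⟨n - 1, hl⟩
  rw [gap, dif_neg (show ¬ (n - 1 + 1 < n) by omega)] at hlast
  have lo (i : Fin n) : θ ⟨0, hpos⟩ ≤ θ i := hθ.monotone (Fin.mk_le_of_le_val (Nat.zero_le _))
  have hi (i : Fin n) : θ i ≤ θ ⟨n - 1, hl⟩ :=
    hθ.monotone (Fin.le_def.2 (Nat.le_sub_one_of_lt i.isLt))
  have h1 := lo i
  have h2 := lo j
  have h3 := hi i
  have h4 := hi j
  have hk1 : (k : ℝ) < 1 := by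
    by_contra hc
    nlinarith [pi_pos]
  have hk2 : (-1 : ℝ) < k := by
    by_contra hc
    nlinarith [pi_pos]
  have hk0 : k = 0 := by
    have : k < 1 := by exact_mod_cast hk1
    have : -1 < k := by exact_mod_cast hk2
    omega
  exact hθ.injective (by simpa [hk0] using hk)

/-- If a similarity-equivariant deterministic oblivious algorithm `A` solves UTP in
finite time, then in a strict biangular circle every activated robot moves: its
destination differs from its current position. -/
theorem UTP_strict_biangular_must_move (p n : ℕ) (hp : 2 ≤ p) (hnp : n = 2 * p)
    (c : ℂ) (ρ : ℝ) (hρ : 0 < ρ)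
    (A : ℂ → Multiset ℂ → ℂ) (hA : Equivariant A) (hsolve : SolvesUTP n c ρ A)
    (P : Multiset ℂ) (hP : IsStrictBiangularOn n c ρ P) :
    ∀ x ∈ P, A x P ≠ x := by
  subst hnp
  obtain ⟨θ, α, β, hne, hα, hβ, hθ, hgap, hPθ⟩ := hP
  have hn : 0 < 2 * p := by omega
  have hp0 : 0 < p := by omega
  have hang (i : Fin (2 * p)) : θ i = biangle (θ ⟨0, hn⟩) α β i :=
    eq_biangle_of_gap hn hgap i i.isLt
  have hsum := mul_add_eq_two_pi_of_gap hn rfl hgap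
  have hinj : Function.Injective fun i => circlePoint c ρ (θ i) :=
    circlePoint_injective_of_gap c hρ hθ fun i => by rw [hgap]; split_ifs <;> assumption
  replace hPθ : P = Multiset.map (fun i => circlePoint c ρ (θ i)) Finset.univ.val := hPθ
  have hnodup : P.Nodup := hPθ ▸ Finset.univ.nodup.map hinj
  have hmem (y : ℂ) : y ∈ P ↔ ∃ i, circlePoint c ρ (θ i) = y := by simp [hPθ]
  intro x hx hfix
  have hall (j : Fin (2 * p)) : A (circlePoint c ρ (θ j)) P = circlePoint c ρ (θ j) := by
    obtain ⟨i, rfl⟩ := (hmem x).1 hx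
    obtain ⟨f, hf, hfij, hfP⟩ := exists_similarity_biangle c hρ hp0 (θ ⟨0, hn⟩) α β hsum i j
    rw [← hang, ← hang] at hfij
    rw [← hfij]
    refine hA.fixed_of_fixed hf hnodup (fun y hy => ?_) hfix
    obtain ⟨k, rfl⟩ := (hmem y).1 hy
    obtain ⟨l, hl, hlk⟩ := hfP k
    exact (hmem _).2 ⟨⟨l, hl⟩, by rw [hang k, ← hlk, hang]⟩
  have hstay := exec_eq_of_fixed (x₀ := fun i => circlePoint c ρ (θ i))
    (fun i => hPθ ▸ hall i) fun _ => Set.univ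
  obtain ⟨-, t, ht⟩ := hsolve _ hinj (fun i => circlePoint_mem_sphere c hρ _) (fun _ => Set.univ)
    ⟨fun _ => ⟨⟨0, hn⟩, trivial⟩, fun _ T => ⟨T, le_rfl, trivial⟩⟩
  rw [hstay] at ht
  have hn1 : 1 < 2 * p := by omega
  obtain ⟨m, hm⟩ := ht.exists_int hρ ⟨1, hn1⟩ ⟨0, hn⟩
  have hα' : θ ⟨1, hn1⟩ - θ ⟨0, hn⟩ = α := by rw [hang ⟨1, hn1⟩]; simp [biangle]
  rw [hα', ← hsum] at hm
  have hpR : (0 : ℝ) < p := by exact_mod_cast hp0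
  have hm' : 2 * α = m * (α + β) := by
    refine mul_left_cancel₀ hpR.ne' ?_
    push_cast at hm
    linarith
  have hm0 : (0 : ℝ) < m := by
    by_contra hc
    nlinarith
  have hm2 : (m : ℝ) < 2 := by
    by_contra hc
    nlinarith
  have hm1 : m = 1 := by
    have : 0 < m := by exact_mod_cast hm0
    have : m < 2 := by exact_mod_cast hm2
    omega
  rw [hm1] at hm'
  exact hne (by push_cast at hm'; linarith)
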